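/- Let B be a Boolean algebra and let M = B^{*∧∨} \ {𝟎, 𝟏} be the set of non-constant lattice homomorphisms from B to the two-element chain. Then the closures C1 and C2 generated on M coincide and form an exact topological closure (hence a topology on M), and the map p ↦ UP_M(p) is an order isomorphism from B onto the collection of clopen subsets of this topological space ordered by set inclusion. -/

import Mathlib

open Set

variable {P : Type*}

/-- `UP_A(p) = {x ∈ A : x p = 1}`, as a subset of the subtype `↥A`. -/
def UPa [PartialOrder P] (A : Set (P →o Bool)) (p : P) : Set ↥A := {x | x.1 p = true}

/-- `LO_A(p) = {x ∈ A : x p = 0}`, as a subset of the subtype `↥A`. -/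
def LOa [PartialOrder P] (A : Set (P →o Bool)) (p : P) : Set ↥A := {x | x.1 p = false}

/-- The closure operator generated by a family `K` of subsets of `M`:
`C(X) = ⋂ {k ∈ K : X ⊆ k}` (the empty intersection being `M`). -/
def closGen {M : Type*} (K : Set (Set M)) (X : Set M) : Set M := ⋂₀ {k ∈ K | X ⊆ k}

/-- The closure `C1` on `A` generated by `{UP_A(p) : p ∈ P}`. -/
def C1a [PartialOrder P] (A : Set (P →o Bool)) : Set ↥A → Set ↥A :=
  closGen (Set.range (UPa A))

/-- The closure `C2` on `A` generated by `{LO_A(p) : p ∈ P}`. -/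
def C2a [PartialOrder P] (A : Set (P →o Bool)) : Set ↥A → Set ↥A :=
  closGen (Set.range (LOa A))

/-- `C1O2(A)`: the subsets of `A` that are `C1`-closed and `C2`-open. -/
def C1O2 [PartialOrder P] (A : Set (P →o Bool)) : Set (Set ↥A) :=
  {B | C1a A B = B ∧ C2a A Bᶜ = Bᶜ}

/-- An `A`-ideal: an intersection of kernels of elements of some `S ⊆ A`. -/
def IsIdealOf [PartialOrder P] (A : Set (P →o Bool)) (I : Set P) : Prop :=
  ∃ S ⊆ A, I = ⋂ x ∈ S, {p : P | x p = false}

/-- An `A`-filter: an intersection of co-kernels of elements of some `S ⊆ A`. -/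
def IsFilterOf [PartialOrder P] (A : Set (P →o Bool)) (F : Set P) : Prop :=
  ∃ S ⊆ A, F = ⋂ x ∈ S, {p : P | x p = true}

/-- `A` is full: for all `p ≰ q` some `x ∈ A` has `x p = 1`, `x q = 0`. -/
def IsFullSet [PartialOrder P] (A : Set (P →o Bool)) : Prop :=
  ∀ p q : P, ¬ p ≤ q → ∃ x ∈ A, x p = true ∧ x q = false

/-- `A` is separating: any disjoint `A`-ideal and `A`-filter are separated by some `x ∈ A`. -/
def IsSeparatingSet [PartialOrder P] (A : Set (P →o Bool)) : Prop :=
  ∀ I F : Set P, IsIdealOf A I → IsFilterOf A F → I ∩ F = ∅ →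
    ∃ x ∈ A, (∀ p ∈ I, x p = false) ∧ (∀ p ∈ F, x p = true)

/-- `L^{*∧∨}`: the monotone maps `L → 2` preserving binary meets and joins. -/
def LatHoms (L : Type*) [Lattice L] : Set (L →o Bool) :=
  {x | ∀ p q : L, x (p ⊓ q) = (x p && x q) ∧ x (p ⊔ q) = (x p || x q)}

section ClosGen

variable {M : Type*} {K : Set (Set M)}

theorem mem_closGen {X : Set M} {x : M} : x ∈ closGen K X ↔ ∀ k ∈ K, X ⊆ k → x ∈ k := by
  simp [closGen]

theorem subset_closGen (X : Set M) : X ⊆ closGen K X :=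
  fun _ hx => mem_closGen.2 fun _ _ hk => hk hx

theorem closGen_mono {X Y : Set M} (h : X ⊆ Y) : closGen K X ⊆ closGen K Y :=
  fun _ hx => mem_closGen.2 fun k hk hY => mem_closGen.1 hx k hk (h.trans hY)

theorem closGen_eq_self_of_mem {X : Set M} (h : X ∈ K) : closGen K X = X :=
  Subset.antisymm (fun _ hx => mem_closGen.1 hx X h Subset.rfl) (subset_closGen X)

/-- The closure generated by a family closed under binary unions is topological. -/
theorem closGen_union (hK : ∀ k ∈ K, ∀ l ∈ K, k ∪ l ∈ K) (X Y : Set M) :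
    closGen K (X ∪ Y) = closGen K X ∪ closGen K Y := by
  refine Subset.antisymm (fun x hx => ?_)
    (union_subset (closGen_mono subset_union_left) (closGen_mono subset_union_right))
  by_contra h
  simp only [mem_union, mem_closGen, not_or, not_forall] at h
  obtain ⟨⟨k, hk, hXk, hxk⟩, l, hl, hYl, hxl⟩ := h
  exact (mem_closGen.1 hx _ (hK k hk l hl) (union_subset_union hXk hYl)).elim hxk hxl

end ClosGen

/-- The set of non-constant lattice homomorphisms `L → 2`. -/
abbrev nonconstLatHoms (L : Type*) [Lattice L] : Set (L →o Bool) :=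
  LatHoms L \ {OrderHom.const L false, OrderHom.const L true}

theorem LatHoms.map_bot {L : Type*} [Lattice L] [BoundedOrder L] (x : nonconstLatHoms L) :
    x.1 ⊥ = false := by
  by_contra h
  refine x.2.2 (Or.inr (OrderHom.ext _ _ (funext fun p => ?_)))
  have := x.1.monotone (bot_le : ⊥ ≤ p)
  rw [Bool.eq_true_of_not_eq_false h] at this
  exact top_le_iff.1 this

theorem LatHoms.map_top {L : Type*} [Lattice L] [BoundedOrder L] (x : nonconstLatHoms L) :
    x.1 ⊤ = true := by
  by_contra h
  refine x.2.2 (Or.inl (OrderHom.ext _ _ (funext fun p => ?_)))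
  have := x.1.monotone (le_top : p ≤ ⊤)
  rw [Bool.eq_false_of_not_eq_true h] at this
  exact le_bot_iff.1 this

/-- The prime ideal theorem, in terms of homomorphisms to the two-element chain. -/
theorem exists_nonconstLatHoms_separating {L : Type*} [DistribLattice L]
    {F : Order.PFilter L} {I : Order.Ideal L} (h : Disjoint (F : Set L) (I : Set L)) :
    ∃ x : nonconstLatHoms L, (∀ p ∈ F, x.1 p = true) ∧ ∀ p ∈ I, x.1 p = false := by
  classical
  obtain ⟨J, hJ, hIJ, hFJ⟩ := DistribLattice.prime_ideal_of_disjoint_filter_ideal h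
  let x : L →o Bool :=
    ⟨fun p => decide (p ∉ J), fun p q hpq => by
      simpa [Bool.le_iff_imp] using fun hp hq => hp (J.lower hpq hq)⟩
  have hF : ∀ p ∈ F, x p = true := fun p hp => by simpa [x] using disjoint_left.1 hFJ hp
  have hI : ∀ p ∈ I, x p = false := fun p hp => by simpa [x] using hIJ hp
  refine ⟨⟨x, fun p q => ⟨?_, ?_⟩, ?_⟩, hF, hI⟩
  · have : p ⊓ q ∈ J ↔ p ∈ J ∨ q ∈ J :=
      ⟨hJ.mem_or_mem, fun h => h.elim (J.lower inf_le_left) (J.lower inf_le_right)⟩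
    simp [x, this]
  · simp [x, Order.Ideal.sup_mem_iff, Bool.decide_and, Bool.not_and]
  · obtain ⟨a, ha⟩ := F.nonempty
    obtain ⟨b, hb⟩ := I.nonempty
    rintro (hx | hx)
    · simpa [hx] using hF a ha
    · have := hI b hb
      rw [mem_singleton_iff.1 hx] at this
      simp at this

theorem UPa_sup {L : Type*} [Lattice L] (p q : L) :
    UPa (nonconstLatHoms L) (p ⊔ q) = UPa (nonconstLatHoms L) p ∪ UPa (nonconstLatHoms L) q := by
  ext x
  simp [UPa, (x.2.1 p q).2]

theorem UPa_inf {L : Type*} [Lattice L] (p q : L) :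
    UPa (nonconstLatHoms L) (p ⊓ q) = UPa (nonconstLatHoms L) p ∩ UPa (nonconstLatHoms L) q := by
  ext x
  simp [UPa, (x.2.1 p q).1]

theorem UPa_mono [PartialOrder P] (A : Set (P →o Bool)) : Monotone (UPa A) :=
  fun _ _ h x hx => top_le_iff.1 (hx.symm.trans_le (x.1.monotone h))

theorem UPa_compl_eq_LOa [PartialOrder P] (A : Set (P →o Bool)) (p : P) :
    (UPa A p)ᶜ = LOa A p := by
  ext x
  simp [UPa, LOa]

theorem UPa_bot {L : Type*} [Lattice L] [BoundedOrder L] : UPa (nonconstLatHoms L) ⊥ = ∅ := by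
  ext x
  simp [UPa, LatHoms.map_bot x]

theorem UPa_top {L : Type*} [Lattice L] [BoundedOrder L] : UPa (nonconstLatHoms L) ⊤ = univ := by
  ext x
  simp [UPa, LatHoms.map_top x]

theorem UPa_subset_UPa_iff {L : Type*} [DistribLattice L] {p q : L} :
    UPa (nonconstLatHoms L) p ⊆ UPa (nonconstLatHoms L) q ↔ p ≤ q := by
  refine ⟨fun h => ?_, fun h => UPa_mono _ h⟩
  by_contra hpq
  obtain ⟨x, hx1, hx0⟩ := exists_nonconstLatHoms_separating
    (F := Order.PFilter.principal p) (I := Order.Ideal.principal q)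
    (disjoint_left.2 fun r hpr hrq => hpq (le_trans hpr hrq))
  have hq : x.1 q = true := h (hx1 p le_rfl)
  simp [hx0 q le_rfl] at hq

theorem UPa_compl {B : Type*} [BooleanAlgebra B] (p : B) :
    UPa (nonconstLatHoms B) pᶜ = (UPa (nonconstLatHoms B) p)ᶜ := by
  refine IsCompl.eq_compl (IsCompl.of_eq ?_ ?_)
  · exact (UPa_inf _ _).symm.trans (by rw [compl_inf_eq_bot, UPa_bot]; rfl)
  · exact (UPa_sup _ _).symm.trans (by rw [compl_sup_eq_top, UPa_top]; rfl)

theorem C1a_eq_C2a {B : Type*} [BooleanAlgebra B] :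
    C1a (nonconstLatHoms B) = C2a (nonconstLatHoms B) := by
  have h : LOa (nonconstLatHoms B) = UPa (nonconstLatHoms B) ∘ compl :=
    funext fun p => by rw [← UPa_compl_eq_LOa, ← UPa_compl, Function.comp_apply]
  rw [C1a, C2a, h, compl_surjective.range_comp]

/-- A set that is `C1`-closed and `C2`-open is of the form `UP(p)`. -/
theorem exists_UPa_eq {L : Type*} [DistribLattice L] [BoundedOrder L]
    {X : Set (nonconstLatHoms L)} (h : X ∈ C1O2 (nonconstLatHoms L)) :
    ∃ p, UPa (nonconstLatHoms L) p = X := by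
  obtain ⟨h1, h2⟩ := h
  have hF : Order.IsPFilter {p | X ⊆ UPa (nonconstLatHoms L) p} :=
    .of_def ⟨⊤, by simp [UPa_top]⟩
      (fun p hp q hq => ⟨p ⊓ q, by simpa [UPa_inf] using ⟨hp, hq⟩, inf_le_left, inf_le_right⟩)
      fun hpq hp => hp.trans (UPa_mono _ hpq)
  have hI : Order.IsIdeal {p | UPa (nonconstLatHoms L) p ⊆ X} :=
    ⟨fun _ _ hpq hp => (UPa_mono _ hpq).trans hp, ⟨⊥, by simp [UPa_bot]⟩,
      fun p hp q hq => ⟨p ⊔ q, by simpa [UPa_sup] using ⟨hp, hq⟩, le_sup_left, le_sup_right⟩⟩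
  by_contra! hne
  obtain ⟨x, hx1, hx0⟩ := exists_nonconstLatHoms_separating (F := hF.toPFilter) (I := hI.toIdeal)
    (disjoint_left.2 fun p hpF hpI => hne p (Subset.antisymm hpI hpF))
  have hxX : x ∈ X := by
    rw [← h1]
    exact mem_closGen.2 (forall_mem_range.2 hx1)
  have hxX' : x ∈ Xᶜ := by
    rw [← h2]
    refine mem_closGen.2 (forall_mem_range.2 fun p hp => hx0 p ?_)
    rw [← UPa_compl_eq_LOa] at hp
    exact compl_subset_compl.1 hp
  exact hxX' hxX

/-- Stone: for a Boolean algebra `B` and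
`M = B^{*∧∨} \ {𝟎, 𝟏}`, the closures `C1` and `C2` on `M` coincide and form an
exact topological closure, and `p ↦ UP_M(p)` is an order isomorphism from `B` onto
the collection of clopen subsets of the resulting topological space. -/
theorem stmt18 {B : Type*} [BooleanAlgebra B] :
    C1a (LatHoms B \ {OrderHom.const B false, OrderHom.const B true}) =
      C2a (LatHoms B \ {OrderHom.const B false, OrderHom.const B true}) ∧
    C1a (LatHoms B \ {OrderHom.const B false, OrderHom.const B true}) ∅ = ∅ ∧
    (∀ X Y : Set ↥(LatHoms B \ {OrderHom.const B false, OrderHom.const B true}),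
      C1a (LatHoms B \ {OrderHom.const B false, OrderHom.const B true}) (X ∪ Y) =
        C1a (LatHoms B \ {OrderHom.const B false, OrderHom.const B true}) X ∪
        C1a (LatHoms B \ {OrderHom.const B false, OrderHom.const B true}) Y) ∧
    (∀ p : B, UPa (LatHoms B \ {OrderHom.const B false, OrderHom.const B true}) p ∈
      {X | C1a (LatHoms B \ {OrderHom.const B false, OrderHom.const B true}) X = X ∧
           C1a (LatHoms B \ {OrderHom.const B false, OrderHom.const B true}) Xᶜ = Xᶜ}) ∧
    Function.Injective (UPa (LatHoms B \ {OrderHom.const B false, OrderHom.const B true})) ∧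
    (∀ X ∈ {X | C1a (LatHoms B \ {OrderHom.const B false, OrderHom.const B true}) X = X ∧
           C1a (LatHoms B \ {OrderHom.const B false, OrderHom.const B true}) Xᶜ = Xᶜ},
      ∃ p : B, UPa (LatHoms B \ {OrderHom.const B false, OrderHom.const B true}) p = X) ∧
    (∀ p q : B, p ≤ q ↔
      UPa (LatHoms B \ {OrderHom.const B false, OrderHom.const B true}) p ⊆
        UPa (LatHoms B \ {OrderHom.const B false, OrderHom.const B true}) q) := by
  refine ⟨C1a_eq_C2a, closGen_eq_self_of_mem ⟨⊥, UPa_bot⟩, closGen_union ?_, fun p => ⟨?_, ?_⟩,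
    fun p q h => ?_, fun X hX => exists_UPa_eq ⟨hX.1, ?_⟩, fun p q => UPa_subset_UPa_iff.symm⟩
  · rintro _ ⟨p, rfl⟩ _ ⟨q, rfl⟩
    exact ⟨p ⊔ q, UPa_sup p q⟩
  · exact closGen_eq_self_of_mem ⟨p, rfl⟩
  · exact closGen_eq_self_of_mem ⟨pᶜ, UPa_compl p⟩
  · exact le_antisymm (UPa_subset_UPa_iff.1 h.subset) (UPa_subset_UPa_iff.1 h.superset)
  · rw [← C1a_eq_C2a]
    exact hX.2
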